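/- arXiv:2304.09624 — 2 statements merged into one kernel-verified Lean document; each statement's English description precedes it below -/
import Mathlib

section
/- Let E be a Polish space and let (K_n)_{n≥0} be an increasing sequence of compact subsets of E. For a measurable path x : [0,∞) → E, let μ_x denote the Borel probability measure on E × [0,∞) obtained as the pushforward of the measure e^{-t} dt on [0,∞) under the map t ↦ (x(t), t). Then the family of measures { μ_x : x is a measurable path such that for every n ≥ 0 the Lebesgue measure of { t ∈ [0,n] : x(t) ∉ K_n } is zero } is tight, and hence relatively compact for the topology of weak convergence of probability measures on E × [0,∞). -/
open MeasureTheory Topology Filter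
open scoped ENNReal

/-- The exponential measure `e^{-t} dt` on `[0,∞)`. -/
noncomputable def expMeasure : Measure ℝ :=
  (volume.restrict (Set.Ici (0 : ℝ))).withDensity fun t => ENNReal.ofReal (Real.exp (-t))

/-- The pseudo-path measure associated with a measurable path `x : ℝ → E`:
the pushforward of `e^{-t} dt` on `[0,∞)` under `t ↦ (x t, t)`. -/
noncomputable def pseudoPath {E : Type*} [MeasurableSpace E] (x : ℝ → E) :
    Measure (E × ℝ) :=
  Measure.map (fun t => (x t, t)) expMeasure

instance : IsFiniteMeasure expMeasure :=
  isFiniteMeasure_withDensity_ofReal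
    ((integrableOn_Ici_iff_integrableOn_Ioi (by simp)).2 (integrableOn_exp_neg_Ioi 0)).2

/-- The exponential measure is carried by `[0,∞)`. -/
lemma expMeasure_compl_Ici : expMeasure (Set.Ici 0)ᶜ = 0 :=
  withDensity_absolutelyContinuous _ _ (by
    rw [Measure.restrict_apply measurableSet_Ici.compl, Set.compl_inter_self, measure_empty])

lemma expMeasure_absolutelyContinuous : expMeasure ≪ volume :=
  (withDensity_absolutelyContinuous _ _).trans Measure.restrict_le_self.absolutelyContinuous

lemma exists_nat_expMeasure_compl_Icc_le {ε : ℝ≥0∞} (hε : 0 < ε) :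
    ∃ N : ℕ, expMeasure (Set.Icc 0 (N : ℝ))ᶜ ≤ ε := by
  have hlim : Tendsto (fun N : ℕ => expMeasure (Set.Ioi (N : ℝ))) atTop (𝓝 0) := by
    have h := tendsto_measure_iInter_atTop (μ := expMeasure)
      (s := fun N : ℕ => Set.Ioi (N : ℝ)) (fun _ => measurableSet_Ioi.nullMeasurableSet)
      (fun _ _ hmn => Set.Ioi_subset_Ioi (Nat.cast_le.2 hmn)) ⟨0, measure_ne_top _ _⟩
    have hempty : ⋂ N : ℕ, Set.Ioi (N : ℝ) = ∅ := by
      refine Set.eq_empty_iff_forall_notMem.2 fun t ht => ?_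
      obtain ⟨N, hN⟩ := exists_nat_ge t
      exact (Set.mem_iInter.1 ht N).not_ge hN
    rwa [hempty, measure_empty] at h
  obtain ⟨N, hN⟩ := (hlim.eventually_le_const hε).exists
  refine ⟨N, ?_⟩
  calc expMeasure (Set.Icc 0 (N : ℝ))ᶜ
      = expMeasure ((Set.Ici 0)ᶜ ∪ (Set.Ioi (N : ℝ))) := by
        rw [← Set.Ici_inter_Iic, Set.compl_inter, Set.compl_Iic]
    _ ≤ expMeasure (Set.Ici 0)ᶜ + expMeasure (Set.Ioi (N : ℝ)) := measure_union_le _ _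
    _ ≤ ε := by rwa [expMeasure_compl_Ici, zero_add]

/-- A path that stays in `A` for almost every time in `[0,T]` has a pseudo-path measure which
charges the complement of `A × [0,T]` no more than the exponential measure charges that of
`[0,T]`. -/
lemma pseudoPath_compl_prod_Icc_le {E : Type*} [MeasurableSpace E] {A : Set E}
    (hA : MeasurableSet A) {T : ℝ} {x : ℝ → E} (hx : Measurable x)
    (hxA : volume {t : ℝ | t ∈ Set.Icc 0 T ∧ x t ∉ A} = 0) :
    pseudoPath x (A ×ˢ Set.Icc 0 T)ᶜ ≤ expMeasure (Set.Icc 0 T)ᶜ := by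
  rw [pseudoPath, Measure.map_apply (by fun_prop) (hA.prod measurableSet_Icc).compl]
  calc expMeasure ((fun t => (x t, t)) ⁻¹' (A ×ˢ Set.Icc 0 T)ᶜ)
      ≤ expMeasure ({t | t ∈ Set.Icc 0 T ∧ x t ∉ A} ∪ (Set.Icc 0 T)ᶜ) := by
        refine measure_mono fun t ht => ?_
        by_cases h : t ∈ Set.Icc 0 T
        · exact Or.inl ⟨h, fun hA => ht ⟨hA, h⟩⟩
        · exact Or.inr h
    _ ≤ expMeasure {t | t ∈ Set.Icc 0 T ∧ x t ∉ A} + expMeasure (Set.Icc 0 T)ᶜ :=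
        measure_union_le _ _
    _ = expMeasure (Set.Icc 0 T)ᶜ := by rw [expMeasure_absolutelyContinuous hxA, zero_add]

/-- The family of pseudo-path measures of paths staying (a.e. in time) in an increasing
family of compact sets is tight, hence relatively compact for the weak convergence topology. -/
theorem stmt_0 {E : Type*} [MetricSpace E] [PolishSpace E] [MeasurableSpace E] [BorelSpace E]
    (K : ℕ → Set E) (hK : ∀ n, IsCompact (K n)) (hmono : Monotone K) :
    (∀ ε : ℝ≥0∞, 0 < ε → ∃ C : Set (E × ℝ), IsCompact C ∧
      ∀ x : ℝ → E, Measurable x →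
        (∀ n : ℕ, volume {t : ℝ | t ∈ Set.Icc (0 : ℝ) (n : ℝ) ∧ x t ∉ K n} = 0) →
        pseudoPath x Cᶜ ≤ ε) ∧
    IsCompact (closure {μ : ProbabilityMeasure (E × ℝ) |
      ∃ x : ℝ → E, Measurable x ∧
        (∀ n : ℕ, volume {t : ℝ | t ∈ Set.Icc (0 : ℝ) (n : ℝ) ∧ x t ∉ K n} = 0) ∧
        (μ : Measure (E × ℝ)) = pseudoPath x}) := by
  have htight : ∀ ε : ℝ≥0∞, 0 < ε → ∃ C : Set (E × ℝ), IsCompact C ∧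
      ∀ x : ℝ → E, Measurable x →
        (∀ n : ℕ, volume {t : ℝ | t ∈ Set.Icc (0 : ℝ) (n : ℝ) ∧ x t ∉ K n} = 0) →
        pseudoPath x Cᶜ ≤ ε := by
    intro ε hε
    obtain ⟨N, hN⟩ := exists_nat_expMeasure_compl_Icc_le hε
    exact ⟨K N ×ˢ Set.Icc 0 (N : ℝ), (hK N).prod isCompact_Icc, fun x hx hxK =>
      (pseudoPath_compl_prod_Icc_le (hK N).measurableSet hx (hxK N)).trans hN⟩
  refine ⟨htight, isCompact_closure_of_isTightMeasureSet
    (isTightMeasureSet_iff_exists_isCompact_measure_compl_le.2 fun ε hε => ?_)⟩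
  obtain ⟨C, hC, hCx⟩ := htight ε hε
  refine ⟨C, hC, ?_⟩
  rintro _ ⟨μ, ⟨x, hx, hxK, hμ⟩, rfl⟩
  exact hμ ▸ hCx x hx hxK
end

section
/- Fix t > 0 and define p(y) = ∑_{k ∈ ℤ} ((4k + 1 − y) / (√(2π) · t^{3/2})) · exp(−(4k + 1 − y)² / (2t)) for y ∈ ℝ. Then for every y ∈ (−1, 1), p is differentiable at y with derivative p′(y) = −(π²/16) · ∑_{k ∈ ℤ} cos(kπ(1 − y)/2) · k² · exp(−t π² k² / 8). -/
/-- A Poisson-type identity: the odd periodised Gaussian series as a sine series. -/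
theorem tsum_mul_gaussian_eq_tsum_sin {t : ℝ} (ht : 0 < t) (x : ℝ) :
    (∑' k : ℤ, (4 * (k : ℝ) + x) / (Real.sqrt (2 * Real.pi) * t ^ ((3 : ℝ) / 2)) *
        Real.exp (-(4 * (k : ℝ) + x) ^ 2 / (2 * t))) =
      ∑' k : ℤ, Real.pi / 8 * ((k : ℝ) * Real.sin ((k : ℝ) * Real.pi * x / 2) *
        Real.exp (-t * Real.pi ^ 2 * (k : ℝ) ^ 2 / 8)) := by
  have hπ := Real.pi_pos
  set T : ℝ := t * Real.pi / 8 with hT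
  have hT0 : 0 < T := by positivity
  set w : ℂ := ((-x / 4 : ℝ) : ℂ) with hw
  set τ : ℂ := Complex.I * (T : ℂ) with hτdef
  have hTc : (T : ℂ) ≠ 0 := by exact_mod_cast hT0.ne'
  have hI : 1 / τ = -Complex.I / T := by
    rw [hτdef]; field_simp; simp
  have hτ : 0 < τ.im := by simpa [hτdef] using hT0
  have hτ' : 0 < (-1 / τ).im := by
    have : -1 / τ = Complex.I * ((1 / T : ℝ) : ℂ) := by
      rw [neg_div, hI]; push_cast; ring
    rw [this]
    simpa using hT0
  have hsq : (-Complex.I * τ) ^ (1 / 2 : ℂ) = ((Real.sqrt T : ℝ) : ℂ) := by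
    have : -Complex.I * τ = (T : ℂ) := by
      rw [hτdef, ← mul_assoc]; simp
    rw [this, Real.sqrt_eq_rpow, Complex.ofReal_cpow hT0.le]
    norm_num
  have h1 := hasSum_jacobiTheta₂'_term w hτ
  have h2 := ((hasSum_jacobiTheta₂'_term (w / τ) hτ').sub
    ((hasSum_jacobiTheta₂_term (w / τ) hτ').mul_left (2 * Real.pi * Complex.I * w))).mul_left
      (1 / (-Complex.I * τ) ^ (1 / 2 : ℂ) * Complex.exp (-Real.pi * Complex.I * w ^ 2 / τ) / τ)
  rw [← jacobiTheta₂'_functional_equation] at h2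
  have e2 : ∀ n : ℤ, 1 / (-Complex.I * τ) ^ (1 / 2 : ℂ) *
      Complex.exp (-Real.pi * Complex.I * w ^ 2 / τ) / τ *
      (jacobiTheta₂'_term n (w / τ) (-1 / τ) -
        2 * Real.pi * Complex.I * w * jacobiTheta₂_term n (w / τ) (-1 / τ)) =
      ((2 * Real.pi / (4 * T * Real.sqrt T) * ((4 * (n : ℝ) + x) *
        Real.exp (-(4 * (n : ℝ) + x) ^ 2 / (2 * t))) : ℝ) : ℂ) := by
    intro n
    have hexp : Complex.exp (-Real.pi * Complex.I * w ^ 2 / τ) *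
        jacobiTheta₂_term n (w / τ) (-1 / τ) =
        ((Real.exp (-(4 * (n : ℝ) + x) ^ 2 / (2 * t)) : ℝ) : ℂ) := by
      rw [jacobiTheta₂_term, ← Complex.exp_add, Complex.ofReal_exp]
      congr 1
      have htc : (t : ℂ) ≠ 0 := by exact_mod_cast ht.ne'
      have hπc : (Real.pi : ℂ) ≠ 0 := by exact_mod_cast hπ.ne'
      rw [hτdef, hw, hT]
      push_cast
      field_simp
      ring
    have hs : ((Real.sqrt T : ℝ) : ℂ) ≠ 0 := by
      exact_mod_cast (Real.sqrt_pos.2 hT0).ne'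
    rw [hsq, jacobiTheta₂'_term, Complex.ofReal_mul, Complex.ofReal_mul, ← hexp, hτdef, hw]
    push_cast
    field_simp
    ring
  simp_rw [e2] at h2
  have h3 := Complex.hasSum_re h2
  have h4 := Complex.hasSum_re h1
  simp_rw [Complex.ofReal_re] at h3
  have e1 : ∀ n : ℤ, (jacobiTheta₂'_term n w τ).re =
      2 * Real.pi * ((n : ℝ) * Real.sin ((n : ℝ) * Real.pi * x / 2) *
        Real.exp (-t * Real.pi ^ 2 * (n : ℝ) ^ 2 / 8)) := by
    intro n
    have : 2 * Real.pi * Complex.I * n * w + Real.pi * Complex.I * (n : ℂ) ^ 2 * τ =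
        ((-t * Real.pi ^ 2 * (n : ℝ) ^ 2 / 8 : ℝ) : ℂ) +
          ((-((n : ℝ) * Real.pi * x / 2) : ℝ) : ℂ) * Complex.I := by
      rw [hτdef, hw, hT]
      push_cast
      linear_combination (Real.pi * (n : ℂ) ^ 2 * (t * Real.pi / 8)) * Complex.I_sq
    have h' : 2 * Real.pi * Complex.I * (n : ℂ) =
        ((2 * Real.pi * (n : ℝ) : ℝ) : ℂ) * Complex.I := by
      push_cast; ring
    have hre : ∀ a b c : ℝ, ((c : ℂ) * Complex.I * Complex.exp (a + b * Complex.I)).re =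
        -(c * (Real.exp a * Real.sin b)) := by
      intro a b c
      simp [Complex.exp_re, Complex.exp_im]
    rw [jacobiTheta₂'_term, jacobiTheta₂_term, this, h', hre, Real.sin_neg]
    ring
  simp_rw [e1] at h4
  have hc : Real.sqrt (2 * Real.pi) * t ^ ((3 : ℝ) / 2) = 32 / Real.pi * (T * Real.sqrt T) := by
    have ht3 : t ^ ((3 : ℝ) / 2) = t * Real.sqrt t := by
      rw [Real.sqrt_eq_rpow, show (3 : ℝ) / 2 = 1 + 1 / 2 by norm_num, Real.rpow_add ht,
        Real.rpow_one]
    have hs : Real.sqrt (2 * Real.pi) * Real.sqrt t = 4 * Real.sqrt T := by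
      rw [← Real.sqrt_mul (by positivity), show 2 * Real.pi * t = 4 ^ 2 * T by rw [hT]; ring,
        Real.sqrt_mul (by norm_num), Real.sqrt_sq (by norm_num)]
    rw [ht3, mul_left_comm, hs, hT]
    field_simp
    norm_num
  have h5 := (h3.mul_left (1 / 16)).tsum_eq.trans (h4.mul_left (1 / 16)).tsum_eq.symm
  convert h5 using 1
  · refine tsum_congr fun k => ?_
    have hs := Real.sqrt_pos.2 hT0
    rw [hc]
    field_simp
    ring
  · refine tsum_congr fun k => ?_
    ring

/-- Differentiating the strip exit density termwise: for `y ∈ (−1,1)`,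
the function `p(y) = ∑_{k∈ℤ} ((4k+1−y)/(√(2π) t^{3/2})) e^{−(4k+1−y)²/(2t)}` has derivative
`p′(y) = −(π²/16) ∑_{k∈ℤ} cos(kπ(1−y)/2) k² e^{−tπ²k²/8}`. -/
theorem stmt_7 (t : ℝ) (ht : 0 < t) (y : ℝ) (hy : y ∈ Set.Ioo (-1 : ℝ) 1) :
    HasDerivAt
      (fun z : ℝ => ∑' k : ℤ,
        (4 * (k : ℝ) + 1 - z) / (Real.sqrt (2 * Real.pi) * t ^ ((3 : ℝ) / 2)) *
          Real.exp (-(4 * (k : ℝ) + 1 - z) ^ 2 / (2 * t)))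
      (-(Real.pi ^ 2 / 16) *
        ∑' k : ℤ, Real.cos ((k : ℝ) * Real.pi * (1 - y) / 2) * (k : ℝ) ^ 2 *
          Real.exp (-t * Real.pi ^ 2 * (k : ℝ) ^ 2 / 8))
      y := by
  have hπ := Real.pi_pos
  simp_rw [add_sub_assoc, tsum_mul_gaussian_eq_tsum_sin ht, ← tsum_mul_left]
  have hsum : Summable fun k : ℤ => Real.pi ^ 2 / 16 * ((k : ℝ) ^ 2 *
      Real.exp (-t * Real.pi ^ 2 * (k : ℝ) ^ 2 / 8)) := by
    refine Summable.mul_left _ ?_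
    refine (summable_pow_mul_jacobiTheta₂_term_bound 0 (T := t * Real.pi / 8)
      (by positivity) 2).congr fun k => ?_
    rw [Int.cast_abs, sq_abs]
    ring_nf
  refine hasDerivAt_tsum (y₀ := 1)
    (g := fun (k : ℤ) (z : ℝ) => Real.pi / 8 * ((k : ℝ) *
      Real.sin ((k : ℝ) * Real.pi * (1 - z) / 2) *
        Real.exp (-t * Real.pi ^ 2 * (k : ℝ) ^ 2 / 8)))
    (g' := fun (k : ℤ) (z : ℝ) => -(Real.pi ^ 2 / 16) *
      (Real.cos ((k : ℝ) * Real.pi * (1 - z) / 2) * (k : ℝ) ^ 2 *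
        Real.exp (-t * Real.pi ^ 2 * (k : ℝ) ^ 2 / 8))) hsum
    (fun k z => ?_) (fun k z => ?_) ?_ y
  · have h := ((((((hasDerivAt_id z).const_sub 1).const_mul ((k : ℝ) * Real.pi)).div_const 2).sin
      |>.const_mul (k : ℝ)).mul_const (Real.exp (-t * Real.pi ^ 2 * (k : ℝ) ^ 2 / 8))).const_mul
      (Real.pi / 8)
    refine h.congr_deriv ?_
    simp only [id]
    ring
  · rw [norm_mul, norm_mul, norm_mul, norm_neg, Real.norm_of_nonneg (by positivity),
      Real.norm_of_nonneg (sq_nonneg (k : ℝ)), Real.norm_of_nonneg (Real.exp_pos _).le]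
    gcongr
    exact mul_le_of_le_one_left (sq_nonneg _) (Real.abs_cos_le_one _)
  · simp
end
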